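/- Let a and b be integers with 2 ≤ a ≤ b, and let n be a real number with n ≥ ((a+2b)(a+b−2)+2)/b. Then for every real number h with 1 ≤ h ≤ a, ((a+b−h)(n+h)+1)/(a+2b−h) ≤ ((a+b−1)n + (a+b))/(a+2b−1); that is, the function f(h) = ((a+b−h)(n+h)+1)/(a+2b−h) attains its maximum on [1,a] at h = 1. -/

import Mathlib

/-- For integers `2 ≤ a ≤ b` and a real `n ≥ ((a+2b)(a+b−2)+2)/b`, the function
`f(h) = ((a+b−h)(n+h)+1)/(a+2b−h)` satisfies `f(h) ≤ f(1) = ((a+b−1)n+(a+b))/(a+2b−1)`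
for all real `1 ≤ h ≤ a`. -/
theorem f_le_f_one (a b : ℤ) (ha : 2 ≤ a) (hab : a ≤ b) (n : ℝ)
    (hn : n ≥ (((a : ℝ) + 2 * b) * ((a : ℝ) + b - 2) + 2) / (b : ℝ)) :
    ∀ h : ℝ, 1 ≤ h → h ≤ (a : ℝ) →
      (((a : ℝ) + b - h) * (n + h) + 1) / ((a : ℝ) + 2 * b - h) ≤
        (((a : ℝ) + b - 1) * n + ((a : ℝ) + b)) / ((a : ℝ) + 2 * b - 1) := by
  intro h h1 h_le
  have ha' : (2 : ℝ) ≤ a := by exact_mod_cast ha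
  have hab' : (a : ℝ) ≤ b := by exact_mod_cast hab
  have hbn : ((a : ℝ) + 2 * b) * ((a : ℝ) + b - 2) + 2 ≤ n * b :=
    (div_le_iff₀ (by linarith)).mp hn
  rw [div_le_div_iff₀ (by linarith) (by linarith)]
  have hslope : 0 ≤ ((a : ℝ) + 2 * b - 1) * (h - 1) :=
    mul_nonneg (by linarith) (by linarith)
  -- The cross-multiplied difference has `h - 1` as a factor.
  have hdiff : 0 ≤ (h - 1) * ((n * b - (((a : ℝ) + 2 * b) * ((a : ℝ) + b - 2) + 2)) +
      ((a : ℝ) + 2 * b - 1) * (h - 1)) :=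
    mul_nonneg (by linarith) (by linarith)
  linarith
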